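/- arXiv:2404.13098 — 2 statements merged into one kernel-verified Lean document; each statement's English description precedes it below -/
import Mathlib

section
/- Let L ⊆ N with ℓ = |L|. Every feasible solution (Y, Z, s, t, v) of D(L,L) satisfies ⟨A(L), Y⟩ + ℓ·v − 1ᵀt ≤ 0. -/
open Matrix Finset

noncomputable section

/-- `cEmb S i` is the `i`-th smallest element of `S` (ascending order). -/
def cEmb {n : ℕ} (S : Finset (Fin n)) : Fin S.card → Fin n :=
  fun i => (S.orderIsoOfFin rfl i).1

/-- `colsOf A S` = `A(S)`: the submatrix of the columns of `A` indexed by `S`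
in ascending order. -/
def colsOf {d n : ℕ} (A : Matrix (Fin d) (Fin n) ℝ) (S : Finset (Fin n)) :
    Matrix (Fin d) (Fin S.card) ℝ :=
  A.submatrix id (cEmb S)

/-- Matrix `L1` norm: maximum over columns of the sum of absolute values of
the entries in that column. -/
def mnorm1 {d : ℕ} {J : Type} [Fintype J] (B : Matrix (Fin d) J ℝ) : ℝ :=
  ⨆ j : J, ∑ i, |B i j|

/-- Vector `L1` norm. -/
def vnorm1 {d : ℕ} (b : Fin d → ℝ) : ℝ := ∑ i, |b i|

/-- Entrywise positive part `B⁺`. -/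
def mpos {d : ℕ} {J : Type} (B : Matrix (Fin d) J ℝ) : Matrix (Fin d) J ℝ :=
  Matrix.of fun i j => max (B i j) 0

/-- Entrywise negative part `B⁻ = B⁺ - B`. -/
def mneg {d : ℕ} {J : Type} (B : Matrix (Fin d) J ℝ) : Matrix (Fin d) J ℝ :=
  mpos B - B

/-- The feasible region `F(ℓ,m)`.  The column set is `J`; `emb i` is the
column carrying the diagonal position of row `i` (for `H(L,M)` the columns of
`A(M)Π = [A(L), A(M∖L)]` are indexed by `Fin ℓ ⊕ Fin (m-ℓ)` and `emb = Sum.inl`;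
for `H(L,L)` one has `J = Fin ℓ` and `emb = id`). -/
def FeasF (r : ℕ) {ℓ : ℕ} {J : Type} [Fintype J] (emb : Fin ℓ → J)
    (X : Matrix (Fin ℓ) J ℝ) : Prop :=
  (∑ i, X i (emb i)) = (r : ℝ) ∧
  ∀ i j, 0 ≤ X i j ∧ X i j ≤ X i (emb i) ∧ X i (emb i) ≤ 1

/-- Optimal value of problem `H(L,M)`: minimize `‖B - A(L) X‖₁` over `X ∈ F(ℓ,m)`,
where `B = A(M)Π = [A(L), A(M∖L)]`. -/
def optH (r : ℕ) {d ℓ : ℕ} {J : Type} [Fintype J] (emb : Fin ℓ → J)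
    (AL : Matrix (Fin d) (Fin ℓ) ℝ) (B : Matrix (Fin d) J ℝ) : ℝ :=
  sInf {c | ∃ X : Matrix (Fin ℓ) J ℝ, FeasF r emb X ∧ mnorm1 (B - AL * X) = c}

/-- Feasibility for the LP `P(L,M)`. -/
def FeasP (r : ℕ) {d ℓ : ℕ} {J : Type} [Fintype J] (emb : Fin ℓ → J)
    (AL : Matrix (Fin d) (Fin ℓ) ℝ) (B : Matrix (Fin d) J ℝ)
    (X : Matrix (Fin ℓ) J ℝ) (F G : Matrix (Fin d) J ℝ) (u : ℝ) : Prop :=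
  B - AL * X = F - G ∧
  (∀ j, (∑ i, (F i j + G i j)) ≤ u) ∧
  (∀ i j, 0 ≤ F i j) ∧ (∀ i j, 0 ≤ G i j) ∧
  FeasF r emb X

/-- Optimal value of the LP `P(L,M)`. -/
def optP (r : ℕ) {d ℓ : ℕ} {J : Type} [Fintype J] (emb : Fin ℓ → J)
    (AL : Matrix (Fin d) (Fin ℓ) ℝ) (B : Matrix (Fin d) J ℝ) : ℝ :=
  sInf {u | ∃ X F G, FeasP r emb AL B X F G u}

/-- `[C, O]`: padding of an `ℓ×ℓ` matrix `C` to the column set `J`; column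
`emb i'` carries column `i'` of `C`, all other columns are zero. -/
def padCols {ℓ : ℕ} {J : Type} [Fintype J] [DecidableEq J] (emb : Fin ℓ → J)
    (C : Matrix (Fin ℓ) (Fin ℓ) ℝ) : Matrix (Fin ℓ) J ℝ :=
  Matrix.of fun i j => ∑ i', if emb i' = j then C i i' else 0

/-- Feasibility for the dual LP `D(L,M)` (matrix inequalities entrywise;
`-J·diag(s) ≤ Y ≤ J·diag(s)` reads `-(s j) ≤ Y i j ≤ s j`). -/
def FeasD {d ℓ : ℕ} {J : Type} [Fintype J] [DecidableEq J] (emb : Fin ℓ → J)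
    (AL : Matrix (Fin d) (Fin ℓ) ℝ)
    (Y : Matrix (Fin d) J ℝ) (Z : Matrix J (Fin ℓ) ℝ) (s : J → ℝ)
    (t : Fin ℓ → ℝ) (v : ℝ) : Prop :=
  (∀ i j, (ALᵀ * Y + padCols emb (v • (1 : Matrix (Fin ℓ) (Fin ℓ) ℝ))
      - padCols emb (Matrix.diagonal t) - Zᵀ
      + padCols emb (Matrix.diagonal fun i' => ∑ p, Z p i')) i j ≤ 0) ∧
  (∀ i j, -(s j) ≤ Y i j ∧ Y i j ≤ s j) ∧
  (∑ j, s j) ≤ 1 ∧ (∀ j, 0 ≤ s j) ∧ (∀ i, 0 ≤ t i) ∧ (∀ j i, 0 ≤ Z j i)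

/-- Objective of the dual LP `D(L,M)`: `⟨B, Y⟩ + r·v − 1ᵀt`. -/
def objD (r : ℕ) {d ℓ : ℕ} {J : Type} [Fintype J]
    (B Y : Matrix (Fin d) J ℝ) (t : Fin ℓ → ℝ) (v : ℝ) : ℝ :=
  (∑ i, ∑ j, B i j * Y i j) + (r : ℝ) * v - ∑ i, t i

/-- Optimal value of the dual LP `D(L,M)`. -/
def optD (r : ℕ) {d ℓ : ℕ} {J : Type} [Fintype J] [DecidableEq J] (emb : Fin ℓ → J)
    (AL : Matrix (Fin d) (Fin ℓ) ℝ) (B : Matrix (Fin d) J ℝ) : ℝ :=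
  sSup {c | ∃ (Y : Matrix (Fin d) J ℝ) (Z : Matrix J (Fin ℓ) ℝ)
      (s : J → ℝ) (t : Fin ℓ → ℝ) (v : ℝ),
      FeasD emb AL Y Z s t v ∧ objD r B Y t v = c}

/-- Feasibility for problem `R_j(L, X*)`: `0 ≤ γ ≤ diag(X*)`. -/
def FeasR {ℓ : ℕ} (xd γ : Fin ℓ → ℝ) : Prop := ∀ i, 0 ≤ γ i ∧ γ i ≤ xd i

/-- Optimal value of problem `R_j(L, X*)`: minimize `‖a_j - A(L)γ‖₁`
subject to `0 ≤ γ ≤ diag(X*)`. -/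
def optR {d ℓ : ℕ} (AL : Matrix (Fin d) (Fin ℓ) ℝ) (a : Fin d → ℝ)
    (xd : Fin ℓ → ℝ) : ℝ :=
  sInf {c | ∃ γ, FeasR xd γ ∧ vnorm1 (a - AL.mulVec γ) = c}

/-- Every feasible solution `(Y, Z, s, t, v)` of `D(L,L)` satisfies
`⟨A(L), Y⟩ + ℓ·v − 1ᵀt ≤ 0`. -/
theorem stmt8 (d n r : ℕ) (hd : 0 < d) (hn : 0 < n) (hr : 0 < r)
    (A : Matrix (Fin d) (Fin n) ℝ) (L : Finset (Fin n))
    (Y : Matrix (Fin d) (Fin L.card) ℝ) (Z : Matrix (Fin L.card) (Fin L.card) ℝ)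
    (s t : Fin L.card → ℝ) (v : ℝ)
    (hfeas : FeasD id (colsOf A L) Y Z s t v) :
    (∑ i, ∑ j, colsOf A L i j * Y i j) + (L.card : ℝ) * v - ∑ i, t i ≤ 0 := by
  have hdiag : ∀ j, (∑ i, colsOf A L i j * Y i j) + v - t j ≤ 0 := by
    intro j
    have h := hfeas.1 j j
    simp only [padCols, Matrix.add_apply, Matrix.sub_apply, Matrix.of_apply, id_eq,
      Finset.sum_ite_eq', Finset.mem_univ, if_true, Matrix.smul_apply, Matrix.one_apply_eq,
      Matrix.diagonal_apply_eq, Matrix.transpose_apply, Matrix.mul_apply, smul_eq_mul,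
      mul_one] at h
    have hZ : Z j j ≤ ∑ p, Z p j :=
      Finset.single_le_sum (f := fun p => Z p j) (fun p _ => hfeas.2.2.2.2.2 p j)
        (Finset.mem_univ j)
    linarith
  have hsum := Finset.sum_nonpos fun j (_ : j ∈ Finset.univ) => hdiag j
  rw [Finset.sum_sub_distrib, Finset.sum_add_distrib] at hsum
  rw [Finset.sum_comm]
  simpa using hsum
end
end

section
/- Let L ⊂ N with ℓ = |L|. If X* ∈ F(ℓ,ℓ) and γ_j ∈ ℝ^{ℓ} satisfy 0 ≤ γ_j ≤ diag(X*) for every j ∈ N∖L, then for Γ = [γ_j : j ∈ N∖L] and any n×n permutation matrix Π, the matrix X = Π·[[X*, Γ],[O, O]]·Πᵀ belongs to F(n,n) (in particular, the block matrix [[X*, Γ],[O, O]] belongs to F(n,n) and membership in F(n,n) is preserved under simultaneous permutation of rows and columns). -/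
open Matrix Finset

noncomputable section

/-- If `X* ∈ F(ℓ,ℓ)` and `0 ≤ γ_j ≤ diag(X*)` for every `j ∈ N∖L`, then for
`Γ = [γ_j : j ∈ N∖L]` and any `n×n` permutation matrix `Π`, the matrix
`X = Π·[[X*, Γ],[O, O]]·Πᵀ` belongs to `F(n,n)`. -/
theorem stmt14 (n r : ℕ) (hn : 0 < n) (hr : 0 < r)
    (L : Finset (Fin n)) (hL : L ⊂ Finset.univ)
    (X : Matrix (Fin L.card) (Fin L.card) ℝ) (hX : FeasF r id X)
    (Γ : Matrix (Fin L.card) (Fin Lᶜ.card) ℝ)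
    (hΓ : ∀ p, FeasR (fun q => X q q) (fun q => Γ q p))
    (σ : Fin n ≃ (Fin L.card ⊕ Fin Lᶜ.card)) :
    FeasF r (id : Fin n → Fin n)
      ((Matrix.fromBlocks X Γ (0 : Matrix (Fin Lᶜ.card) (Fin L.card) ℝ) 0).submatrix
        σ σ) := by
  refine ⟨?_, fun i j => ?_⟩
  · simp only [id_eq, submatrix_apply]
    rw [Equiv.sum_comp σ (fun a => Matrix.fromBlocks X Γ 0 0 a a), Fintype.sum_sum_type]
    simpa using hX.1
  · simp only [id_eq, submatrix_apply]
    rcases σ i with a | a <;> rcases σ j with b | b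
    · exact hX.2 a b
    · exact ⟨(hΓ b a).1, (hΓ b a).2, (hX.2 a a).2.2⟩
    all_goals simp
end
end
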